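/- arXiv:2309.05050 — 3 statements merged into one kernel-verified Lean document; each statement's English description precedes it below -/
import Mathlib

section
/- Let ξ be the unique solution in (1/4, 2/3) of the equation √(36ξ+3)/4 + sin(2π√(12ξ+1)/3) = 0. Then ξ is transcendental, i.e., ξ is not a root of any nonzero polynomial with rational coefficients. -/
open Real

/-- An entire function vanishing to order at least `r` at `a` is divisible by `(z - a) ^ r`. -/
theorem Differentiable.exists_eq_sub_pow_mul {F : ℂ → ℂ} (hF : Differentiable ℂ F) {a : ℂ} {r : ℕ}
    (hr : (r : ℕ∞) ≤ analyticOrderAt F a) :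
    ∃ G : ℂ → ℂ, Differentiable ℂ G ∧ ∀ z, F z = (z - a) ^ r * G z := by
  induction r with
  | zero => exact ⟨F, hF, by simp⟩
  | succ r ih =>
    obtain ⟨G, hG, hFG⟩ := ih (le_trans (by exact_mod_cast r.le_succ) hr)
    have hGa : G a = 0 := by
      by_contra h
      have hG0 : analyticOrderAt G a = 0 := (hG.analyticAt a).analyticOrderAt_eq_zero.2 h
      have hF' : F = (fun z ↦ z - a) ^ r * G := funext hFG
      rw [hF', analyticOrderAt_mul ((by fun_prop : AnalyticAt ℂ (fun z ↦ z - a) a).pow r)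
        (hG.analyticAt a), hG0, analyticOrderAt_pow (by fun_prop), add_zero] at hr
      have h1 : analyticOrderAt (fun z : ℂ ↦ z - a) a = 1 := analyticOrderAt_id_sub_const_self
      rw [h1, nsmul_eq_mul, mul_one] at hr
      exact absurd hr (by exact_mod_cast Nat.not_succ_le_self r)
    refine ⟨dslope G a, ?_, fun z ↦ ?_⟩
    · rw [← differentiableOn_univ] at hG ⊢
      exact (Complex.differentiableOn_dslope Filter.univ_mem).2 hG
    · have := sub_smul_dslope G a z
      rw [hGa, sub_zero, smul_eq_mul] at this
      rw [hFG, ← this]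
      ring

/-- An entire function vanishing to order at least `r` at every point of `S` is divisible by
`∏ a ∈ S, (z - a) ^ r`. -/
theorem Differentiable.exists_eq_prod_sub_pow_mul {F : ℂ → ℂ} (hF : Differentiable ℂ F)
    (S : Finset ℂ) {r : ℕ} (hr : ∀ a ∈ S, (r : ℕ∞) ≤ analyticOrderAt F a) :
    ∃ G : ℂ → ℂ, Differentiable ℂ G ∧ ∀ z, F z = (∏ a ∈ S, (z - a) ^ r) * G z := by
  induction S using Finset.induction_on with
  | empty => exact ⟨F, hF, by simp⟩
  | insert a S ha ih =>
    obtain ⟨G, hG, hFG⟩ := ih fun b hb ↦ hr b (Finset.mem_insert_of_mem hb)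
    have hP : Differentiable ℂ fun z : ℂ ↦ ∏ b ∈ S, (z - b) ^ r := by fun_prop
    have hPa : analyticOrderAt (fun z : ℂ ↦ ∏ b ∈ S, (z - b) ^ r) a = 0 := by
      rw [(hP.analyticAt a).analyticOrderAt_eq_zero, Finset.prod_ne_zero_iff]
      exact fun b hb ↦ pow_ne_zero _ (sub_ne_zero.2 fun h ↦ ha (h ▸ hb))
    have hGa : (r : ℕ∞) ≤ analyticOrderAt G a := by
      have h := hr a (Finset.mem_insert_self a S)
      have hF' : F = (fun z : ℂ ↦ ∏ b ∈ S, (z - b) ^ r) * G := funext hFG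
      rwa [hF', analyticOrderAt_mul (hP.analyticAt a) (hG.analyticAt a), hPa, zero_add] at h
    obtain ⟨G', hG', hGG'⟩ := hG.exists_eq_sub_pow_mul hGa
    refine ⟨G', hG', fun z ↦ ?_⟩
    rw [hFG, hGG', Finset.prod_insert ha]
    ring

/-- If an entire function vanishes to order `r` at `0, …, m - 1` and is bounded by `B` on the circle
of radius `w + m`, then its `r`-th derivatives at these points are small. -/
theorem norm_iteratedDeriv_le_of_forall_lt_iteratedDeriv_eq_zero {F : ℂ → ℂ}
    (hF : Differentiable ℂ F) {m r : ℕ} {w B : ℝ} (hw : 0 < w)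
    (hzero : ∀ t < r, ∀ s < m, iteratedDeriv t F s = 0)
    (hB : ∀ z : ℂ, ‖z‖ = w + m → ‖F z‖ ≤ B) {s₀ : ℕ} (hs₀ : s₀ < m) :
    ‖iteratedDeriv r F s₀‖ ≤ r.factorial * (((m + 1 : ℝ) ^ m) ^ r * (B / (w ^ m) ^ r)) := by
  obtain ⟨G, hG, hFG⟩ := hF.exists_eq_prod_sub_pow_mul
    ((Finset.range m).image (fun s : ℕ ↦ (s : ℂ))) (r := r) (by
      intro a ha
      obtain ⟨s, hs, rfl⟩ := Finset.mem_image.1 ha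
      rw [natCast_le_analyticOrderAt_iff_iteratedDeriv_eq_zero (hF.analyticAt _)]
      exact fun t ht ↦ hzero t ht s (Finset.mem_range.1 hs))
  have hFG' (z : ℂ) : F z = (∏ s ∈ Finset.range m, (z - s)) ^ r * G z := by
    rw [hFG, Finset.prod_image (by simp), Finset.prod_pow]
  have hm : (0 : ℝ) < m := by exact_mod_cast (Nat.zero_le s₀).trans_lt hs₀
  have hGB (z : ℂ) (hz : ‖z‖ ≤ w + m) : ‖G z‖ ≤ B / (w ^ m) ^ r := by
    refine Complex.norm_le_of_forall_mem_frontier_norm_le (U := Metric.ball 0 (w + m))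
      Metric.isBounded_ball hG.diffContOnCl (fun y hy ↦ ?_) ?_
    · rw [frontier_ball _ (by positivity)] at hy
      have hy : ‖y‖ = w + m := by simpa using hy
      rw [le_div_iff₀ (by positivity), mul_comm]
      refine le_trans ?_ (hB y hy)
      rw [hFG', norm_mul, norm_pow, norm_prod]
      gcongr
      calc w ^ m = ∏ s ∈ Finset.range m, w := by simp
        _ ≤ ∏ s ∈ Finset.range m, ‖y - s‖ := by
          refine Finset.prod_le_prod (fun _ _ ↦ hw.le) fun s hs ↦ ?_
          have h1 := norm_sub_norm_le y s
          have h2 : (s : ℝ) < m := by exact_mod_cast Finset.mem_range.1 hs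
          rw [Complex.norm_natCast] at h1
          linarith
    · rw [closure_ball _ (by positivity)]
      simpa using hz
  have := Complex.norm_iteratedDeriv_le_of_forall_mem_sphere_norm_le (c := (s₀ : ℂ)) (R := 1)
    (C := ((m + 1 : ℝ) ^ m) ^ r * (B / (w ^ m) ^ r)) r one_pos hF.diffContOnCl fun z hz ↦ ?_
  · simpa using this
  · have hz : ‖z - s₀‖ = 1 := by simpa [dist_eq_norm] using hz
    have hs₀' : (s₀ : ℝ) + 1 ≤ m := by exact_mod_cast hs₀
    have hz' : ‖z‖ ≤ m := by
      have := norm_le_norm_sub_add z s₀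
      rw [Complex.norm_natCast] at this
      linarith
    rw [hFG', norm_mul, norm_pow, norm_prod]
    gcongr
    · calc ∏ s ∈ Finset.range m, ‖z - s‖ ≤ ∏ s ∈ Finset.range m, (m + 1 : ℝ) := by
            refine Finset.prod_le_prod (fun _ _ ↦ norm_nonneg _) fun s hs ↦ ?_
            have h1 : ‖z - s‖ ≤ ‖z - s₀‖ + ‖(s₀ : ℂ) - s‖ := norm_sub_le_norm_sub_add_norm_sub ..
            have h2 : ‖(s₀ : ℂ) - s‖ ≤ m := by
              have h3 : (s : ℝ) < m := by exact_mod_cast Finset.mem_range.1 hs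
              have h4 : ((s₀ : ℂ) - s) = (((s₀ : ℝ) - s : ℝ) : ℂ) := by push_cast; rfl
              rw [h4, Complex.norm_real, Real.norm_eq_abs, abs_le]
              have h5 : (0 : ℝ) ≤ s := by positivity
              have h6 : (0 : ℝ) ≤ s₀ := by positivity
              constructor <;> linarith
            linarith
        _ = (m + 1 : ℝ) ^ m := by simp
    · exact hGB z (by linarith)

theorem iteratedDeriv_sum_const_mul_exp {ι : Type*} (S : Finset ι) (c ω : ι → ℂ) (t : ℕ) :
    iteratedDeriv t (fun z ↦ ∑ x ∈ S, c x * Complex.exp (ω x * z)) =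
      fun z ↦ ∑ x ∈ S, c x * ω x ^ t * Complex.exp (ω x * z) := by
  induction t with
  | zero => simp
  | succ t ih =>
    rw [iteratedDeriv_succ, ih]
    funext z
    refine HasDerivAt.deriv (HasDerivAt.fun_sum fun x _ ↦ ?_)
    have := (((hasDerivAt_id z).const_mul (ω x)).cexp).const_mul (c x * ω x ^ t)
    simp only [id] at this
    convert! this using 1
    ring

theorem eq_zero_of_forall_sum_mul_pow_eq_zero {R ι : Type*} [CommRing R] [IsDomain R] [Fintype ι]
    {c ω : ι → R} (hω : Function.Injective ω) (h : ∀ t : ℕ, ∑ x, c x * ω x ^ t = 0) : c = 0 := by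
  let e := Fintype.equivFin ι
  have := Matrix.eq_zero_of_forall_pow_sum_mul_pow_eq_zero (f := ω ∘ e.symm) (v := c ∘ e.symm)
    (hω.comp e.symm.injective) fun i ↦ by
      rw [← h i]
      exact e.symm.sum_comp fun x ↦ c x * ω x ^ (i : ℕ)
  funext x
  simpa using congrFun this (e x)

open NumberField in
/-- **Siegel's lemma** over the ring of integers, for twice as many unknowns as equations. -/
theorem NumberField.exists_house_le_of_card_eq_two_mul (K : Type*) [Field K] [NumberField K] :
    ∃ C : ℝ, 1 ≤ C ∧ ∀ (α β : Type) [Fintype α] [Fintype β] (M : Matrix α β (𝓞 K)) (A : ℝ),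
      M ≠ 0 → 0 < Fintype.card α → Fintype.card β = 2 * Fintype.card α →
      (∀ k l, house (M k l : K) ≤ A) →
      ∃ c : β → 𝓞 K, c ≠ 0 ∧ M.mulVec c = 0 ∧
        ∀ l, house (c l : K) ≤ C * (C * Fintype.card β * A) := by
  classical
  have : ∃ C : ℝ, ∀ (α β : Type) [Fintype α] [Fintype β] (M : Matrix α β (𝓞 K)) (A : ℝ) (p q : ℕ),
      M ≠ 0 → 0 < p → p < q → Fintype.card β = q → Fintype.card α = p →
      (∀ k l, house (M k l : K) ≤ A) →
      ∃ c : β → 𝓞 K, c ≠ 0 ∧ M.mulVec c = 0 ∧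
        ∀ l, house (c l : K) ≤ C * ((C * q * A) ^ ((p : ℝ) / (q - p))) :=
    ⟨_, fun α β _ _ M A p q hM hp hpq hβ hα hA ↦
      house.exists_ne_zero_int_vec_house_le K M hM hp hpq hβ hA hα⟩
  obtain ⟨C, hC⟩ := this
  refine ⟨max 1 |C|, le_max_left _ _, fun α β _ _ M A hM hp hβ hA ↦ ?_⟩
  obtain ⟨c, hc, hMc, hle⟩ := hC α β M A _ _ hM hp (by lia) rfl rfl hA
  refine ⟨c, hc, hMc, fun l ↦ (hle l).trans ?_⟩
  have hp' : (Fintype.card α : ℝ) ≠ 0 := by exact_mod_cast hp.ne'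
  have he : (Fintype.card α : ℝ) / (Fintype.card β - Fintype.card α) = 1 := by
    rw [hβ]
    push_cast
    rw [two_mul, add_sub_cancel_right, div_self hp']
  have hA0 : 0 ≤ A := by
    have ⟨k⟩ := Fintype.card_pos_iff.1 hp
    have ⟨l⟩ := Fintype.card_pos_iff.1 (by lia : 0 < Fintype.card β)
    exact (house_nonneg _).trans (hA k l)
  rw [he, rpow_one, ← mul_assoc, ← mul_assoc, ← mul_assoc, ← mul_assoc]
  gcongr ?_ * _ * _
  calc C * C = |C| * |C| := (abs_mul_abs_self C).symm
    _ ≤ max 1 |C| * max 1 |C| := by gcongr <;> exact le_max_right _ _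

namespace GelfondSchneider

open NumberField

variable {K : Type*} [Field K] [NumberField K]

/-- For `D a`, `D b`, `D g` integral this is `D ^ (t + 2 * N)` times
`(i + j * b) ^ t * (a ^ i * g ^ j) ^ s`, written as a polynomial in the integral elements. -/
def entry (D a b g : 𝓞 K) (N t s i j : ℕ) : 𝓞 K :=
  (i * D + j * b) ^ t * (D ^ (N - i * s) * a ^ (i * s)) * (D ^ (N - j * s) * g ^ (j * s))

theorem map_entry (φ : K →+* ℂ) {D a b g : 𝓞 K} {l β : ℂ}
    (ha : φ a = φ D * Complex.exp l) (hb : φ b = φ D * β)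
    (hg : φ g = φ D * Complex.exp (β * l)) {N t s i j : ℕ} (hi : i * s ≤ N) (hj : j * s ≤ N) :
    φ (entry D a b g N t s i j) =
      φ D ^ (t + 2 * N) * ((i + j * β) ^ t * Complex.exp (l * (i + j * β) * s)) := by
  have h1 : l * (i + j * β) * s = (i * s : ℕ) * l + (j * s : ℕ) * (β * l) := by
    push_cast; ring
  have h2 (k : ℕ) (hk : k ≤ N) (x : ℂ) : φ D ^ (N - k) * (φ D * x) ^ k = φ D ^ N * x ^ k := by
    rw [mul_pow, ← mul_assoc, ← pow_add, Nat.sub_add_cancel hk]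
  simp only [entry, map_mul, map_add, map_pow, map_natCast, ha, hb, hg]
  rw [h2 _ hi, h2 _ hj, h1, Complex.exp_add, Complex.exp_nat_mul, Complex.exp_nat_mul]
  rw [show (i : ℂ) * φ D + j * (φ D * β) = φ D * (i + j * β) by ring, mul_pow]
  ring

theorem house_pow_mul_pow_le {D a : K} {H : ℝ} (hD : house D ≤ H) (ha : house a ≤ H) {N k : ℕ}
    (hk : k ≤ N) : house (D ^ (N - k) * a ^ k) ≤ H ^ N :=
  calc house (D ^ (N - k) * a ^ k) ≤ house D ^ (N - k) * house a ^ k :=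
        (house_mul_le _ _).trans (mul_le_mul (house_pow_le _ _) (house_pow_le _ _)
          (house_nonneg _) (pow_nonneg (house_nonneg _) _))
    _ ≤ H ^ (N - k) * H ^ k := by
        have hH := (house_nonneg D).trans hD
        have := house_nonneg D
        have := house_nonneg a
        gcongr
    _ = H ^ N := by rw [← pow_add, Nat.sub_add_cancel hk]

theorem house_entry_le {D a b g : 𝓞 K} {H : ℝ} (hD : house (D : K) ≤ H) (ha : house (a : K) ≤ H)
    (hb : house (b : K) ≤ H) (hg : house (g : K) ≤ H) {N t s i j q : ℕ}
    (hi : i * s ≤ N) (hj : j * s ≤ N) (hiq : i ≤ q) (hjq : j ≤ q) :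
    house (entry D a b g N t s i j : K) ≤ (2 * q * H) ^ t * H ^ (2 * N) := by
  have hH : 0 ≤ H := (house_nonneg _).trans hD
  have h1 : house ((i : K) * D + j * b) ≤ 2 * q * H :=
    calc house ((i : K) * D + j * b) ≤ i * house (D : K) + j * house (b : K) := by
          rw [← house_nat_mul, ← house_nat_mul]
          exact house_add_le _ _
      _ ≤ q * H + q * H := by
          have := house_nonneg (D : K)
          have := house_nonneg (b : K)
          gcongr
      _ = 2 * q * H := by ring
  simp only [entry, map_mul, map_add, map_pow, map_natCast]
  calc _ ≤ house (((i : K) * D + j * b) ^ t) * house ((D : K) ^ (N - i * s) * a ^ (i * s)) *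
          house ((D : K) ^ (N - j * s) * g ^ (j * s)) :=
        (house_mul_le _ _).trans (mul_le_mul_of_nonneg_right (house_mul_le _ _) (house_nonneg _))
    _ ≤ (2 * q * H) ^ t * H ^ N * H ^ N := by
        gcongr
        · exact house_nonneg _
        · exact house_nonneg _
        · exact (house_pow_le _ _).trans (by gcongr; exact house_nonneg _)
        · exact house_pow_mul_pow_le hD ha hi
        · exact house_pow_mul_pow_le hD hg hj
    _ = _ := by ring

/-- The (scaled) value at `s` of the `t`-th derivative of the auxiliary function. -/
def auxValue (D a b g : 𝓞 K) (N q : ℕ) (c : Fin q × Fin q → 𝓞 K) (t s : ℕ) : 𝓞 K :=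
  ∑ x, entry D a b g N t s x.1 x.2 * c x

/-- The auxiliary function. -/
noncomputable def auxFun (l β : ℂ) {q : ℕ} (d : Fin q × Fin q → ℂ) (z : ℂ) : ℂ :=
  ∑ x, d x * Complex.exp (l * (x.1 + x.2 * β) * z)

theorem differentiable_auxFun (l β : ℂ) {q : ℕ} (d : Fin q × Fin q → ℂ) :
    Differentiable ℂ (auxFun l β d) := by
  unfold auxFun
  fun_prop

theorem val_mul_le_mul {q m s : ℕ} (i : Fin q) (hs : s < m) : (i : ℕ) * s ≤ m * q := by
  rw [mul_comm m]
  exact Nat.mul_le_mul i.2.le hs.le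

theorem map_auxValue (φ : K →+* ℂ) {D a b g : 𝓞 K} {l β : ℂ}
    (ha : φ a = φ D * Complex.exp l) (hb : φ b = φ D * β)
    (hg : φ g = φ D * Complex.exp (β * l)) {m q s : ℕ} (hs : s < m) (c : Fin q × Fin q → 𝓞 K)
    (t : ℕ) :
    l ^ t * φ (auxValue D a b g (m * q) q c t s) =
      φ D ^ (t + 2 * (m * q)) * iteratedDeriv t (auxFun l β fun x ↦ φ (c x)) s := by
  unfold auxFun
  rw [iteratedDeriv_sum_const_mul_exp]
  simp only [auxValue, map_sum, map_mul, Finset.mul_sum]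
  refine Finset.sum_congr rfl fun x _ ↦ ?_
  rw [map_entry φ ha hb hg (val_mul_le_mul x.1 hs) (val_mul_le_mul x.2 hs),
    mul_pow l]
  ring

theorem exists_auxValue_ne_zero (φ : K →+* ℂ) {D a b g : 𝓞 K} {l β : ℂ} (hD : φ D ≠ 0)
    (ha : φ a = φ D * Complex.exp l) (hb : φ b = φ D * β)
    (hg : φ g = φ D * Complex.exp (β * l)) (hβ : ∀ r : ℚ, β ≠ r) {m q : ℕ} (hm : 0 < m)
    {c : Fin q × Fin q → 𝓞 K} (hc : c ≠ 0) :
    ∃ t, auxValue D a b g (m * q) q c t 0 ≠ 0 := by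
  by_contra! h
  refine hc (funext fun x ↦ ?_)
  have hω : Function.Injective fun x : Fin q × Fin q ↦ ((x.1 : ℕ) : ℂ) + (x.2 : ℕ) * β := by
    rintro ⟨i, j⟩ ⟨i', j'⟩ hij
    simp only at hij
    have hj : (j : ℕ) = j' := by
      by_contra hne
      have hne' : ((j : ℕ) : ℂ) - (j' : ℕ) ≠ 0 := sub_ne_zero.2 (by exact_mod_cast hne)
      refine hβ ((((i' : ℕ) : ℚ) - (i : ℕ)) / ((j : ℕ) - (j' : ℕ))) ?_
      push_cast
      rw [eq_div_iff hne']
      linear_combination hij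
    have hi : (i : ℕ) = i' := by
      rw [hj] at hij
      exact_mod_cast add_right_cancel hij
    exact Prod.ext (Fin.ext hi) (Fin.ext hj)
  have := eq_zero_of_forall_sum_mul_pow_eq_zero (c := fun x ↦ φ (c x)) hω fun t ↦ by
    have h1 := congrArg (fun y : 𝓞 K ↦ φ y) (h t)
    simp only [auxValue, map_sum, map_mul, map_zero] at h1
    have h2 : φ D ^ (t + 2 * (m * q)) * ∑ x, φ (c x) * ((x.1 : ℕ) + (x.2 : ℕ) * β) ^ t = 0 := by
      rw [← h1, Finset.mul_sum]
      refine Finset.sum_congr rfl fun x _ ↦ ?_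
      rw [map_entry φ ha hb hg (val_mul_le_mul x.1 hm) (val_mul_le_mul x.2 hm)]
      simp
      ring
    exact (mul_eq_zero.1 h2).resolve_left (pow_ne_zero _ hD)
  have hx := congrFun this x
  simpa using hx

theorem house_auxValue_le {D a b g : 𝓞 K} {H A : ℝ} (hD : house (D : K) ≤ H)
    (ha : house (a : K) ≤ H) (hb : house (b : K) ≤ H) (hg : house (g : K) ≤ H) {m q s : ℕ}
    (hs : s < m) {c : Fin q × Fin q → 𝓞 K} (hc : ∀ x, house (c x : K) ≤ A) (t : ℕ) :
    house (auxValue D a b g (m * q) q c t s : K) ≤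
      q ^ 2 * ((2 * q * H) ^ t * H ^ (2 * (m * q)) * A) := by
  have hH : 0 ≤ H := (house_nonneg _).trans hD
  simp only [auxValue, map_sum, map_mul]
  refine (house_sum_le_sum_house _ _).trans ?_
  calc _ ≤ ∑ x : Fin q × Fin q, (2 * q * H) ^ t * H ^ (2 * (m * q)) * A := by
        refine Finset.sum_le_sum fun x _ ↦ (house_mul_le _ _).trans ?_
        gcongr
        · exact house_nonneg _
        · exact house_entry_le hD ha hb hg (val_mul_le_mul x.1 hs)
            (val_mul_le_mul x.2 hs) x.1.2.le x.2.2.le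
        · exact hc x
    _ = _ := by
        simp only [Finset.sum_const, Finset.card_univ, Fintype.card_prod, Fintype.card_fin,
          nsmul_eq_mul]
        push_cast
        ring

theorem norm_auxFun_le {l β : ℂ} {q : ℕ} {d : Fin q × Fin q → ℂ} {A : ℝ} (hd : ∀ x, ‖d x‖ ≤ A)
    (z : ℂ) : ‖auxFun l β d z‖ ≤ q ^ 2 * (A * Real.exp (‖l‖ * (1 + ‖β‖) * (q * ‖z‖))) := by
  calc _ ≤ ∑ x : Fin q × Fin q, A * Real.exp (‖l‖ * (1 + ‖β‖) * (q * ‖z‖)) := by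
        refine norm_sum_le_of_le _ fun x _ ↦ ?_
        rw [norm_mul]
        have h1 : ‖((x.1 : ℕ) : ℂ) + (x.2 : ℕ) * β‖ ≤ q * (1 + ‖β‖) := by
          have hi : ((x.1 : ℕ) : ℝ) ≤ q := by exact_mod_cast x.1.2.le
          have hj : ((x.2 : ℕ) : ℝ) ≤ q := by exact_mod_cast x.2.2.le
          calc _ ≤ ((x.1 : ℕ) : ℝ) + (x.2 : ℕ) * ‖β‖ := by
                refine (norm_add_le _ _).trans ?_
                rw [norm_mul, Complex.norm_natCast, Complex.norm_natCast]
            _ ≤ q + q * ‖β‖ := by gcongr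
            _ = _ := by ring
        have hA : 0 ≤ A := (norm_nonneg _).trans (hd x)
        gcongr
        · exact hd x
        · rw [Complex.norm_exp]
          gcongr
          refine (Complex.re_le_norm _).trans ?_
          rw [norm_mul, norm_mul]
          calc _ ≤ ‖l‖ * (q * (1 + ‖β‖)) * ‖z‖ := by gcongr
            _ = _ := by ring
    _ = _ := by
        simp only [Finset.sum_const, Finset.card_univ, Fintype.card_prod, Fintype.card_fin,
          nsmul_eq_mul]
        push_cast
        ring

/-- The coefficients of the auxiliary function, obtained from Siegel's lemma. -/
theorem exists_coeff (K : Type*) [Field K] [NumberField K] :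
    ∃ C : ℝ, 1 ≤ C ∧ ∀ {D a b g : 𝓞 K} {H : ℝ}, D ≠ 0 → 1 ≤ H → house (D : K) ≤ H →
      house (a : K) ≤ H → house (b : K) ≤ H → house (g : K) ≤ H →
      ∀ {m n q : ℕ}, 0 < m → 0 < n → q ^ 2 = 2 * (m * n) →
      ∃ c : Fin q × Fin q → 𝓞 K, c ≠ 0 ∧
        (∀ t < n, ∀ s < m, auxValue D a b g (m * q) q c t s = 0) ∧
        ∀ x, house (c x : K) ≤ C * (C * q ^ 2 * ((2 * q * H) ^ n * H ^ (2 * (m * q)))) := by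
  obtain ⟨C, hC1, hC⟩ := exists_house_le_of_card_eq_two_mul K
  refine ⟨C, hC1, fun {D a b g H} hD0 hH hD ha hb hg {m n q} hm hn hq ↦ ?_⟩
  have hq0 : 0 < q := by
    rcases Nat.eq_zero_or_pos q with rfl | h
    · have := Nat.mul_pos hm hn
      simp at hq
      lia
    · exact h
  have hqH : 1 ≤ 2 * (q : ℝ) * H := by
    have : (1 : ℝ) ≤ q := by exact_mod_cast hq0
    nlinarith
  obtain ⟨c, hc, hMc, hle⟩ := hC (Fin m × Fin n) (Fin q × Fin q)
    (fun y x ↦ entry D a b g (m * q) y.2 y.1 x.1 x.2) ((2 * q * H) ^ n * H ^ (2 * (m * q)))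
    (fun h ↦ by
      have h0 := congrFun (congrFun h (⟨0, hm⟩, ⟨0, hn⟩)) (⟨0, hq0⟩, ⟨0, hq0⟩)
      simp [entry, hD0] at h0)
    (by simp [hm, hn]) (by simp; lia) (fun y x ↦ by
      refine (house_entry_le hD ha hb hg (val_mul_le_mul x.1 y.1.2)
        (val_mul_le_mul x.2 y.1.2) x.1.2.le x.2.2.le).trans ?_
      gcongr
      exact y.2.2.le)
  refine ⟨c, hc, fun t ht s hs ↦ congrFun hMc (⟨s, hs⟩, ⟨t, ht⟩), fun x ↦ (hle x).trans_eq ?_⟩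
  simp only [Fintype.card_prod, Fintype.card_fin]
  push_cast
  ring

theorem one_le_norm_mul_house_pow (φ : K →+* ℂ) {x : 𝓞 K} (hx : x ≠ 0) :
    1 ≤ ‖φ x‖ * house (x : K) ^ (Module.finrank ℚ K - 1) := by
  refine le_trans ?_ (norm_norm_le_norm_mul_house_pow (x : K) φ)
  rw [← Algebra.coe_norm_int]
  have : Algebra.norm ℤ x ≠ 0 := Algebra.norm_ne_zero_iff.2 hx
  have h1 := Int.one_le_abs this
  simpa [← Rat.norm_cast_real] using (by exact_mod_cast h1 : (1 : ℝ) ≤ |(Algebra.norm ℤ x : ℝ)|)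

theorem exists_rat_eq (φ : K →+* ℂ) {D a b g : 𝓞 K} {l β : ℂ} (hl : l ≠ 0) (hD : φ D ≠ 0)
    (ha : φ a = φ D * Complex.exp l) (hb : φ b = φ D * β)
    (hg : φ g = φ D * Complex.exp (β * l)) : ∃ r : ℚ, β = r := by
  by_contra! hβ
  obtain ⟨C, hC1, hC⟩ := exists_coeff K
  obtain ⟨h, hh⟩ : ∃ h, Module.finrank ℚ K = h + 1 :=
    Nat.exists_eq_succ_of_ne_zero Module.finrank_pos.ne'
  obtain ⟨H, hH1, hDH, haH, hbH, hgH⟩ : ∃ H : ℝ, 1 ≤ H ∧ house (D : K) ≤ H ∧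
      house (a : K) ≤ H ∧ house (b : K) ≤ H ∧ house (g : K) ≤ H := by
    have h1 := house_nonneg (D : K)
    have h2 := house_nonneg (a : K)
    have h3 := house_nonneg (b : K)
    have h4 := house_nonneg (g : K)
    refine ⟨1 + house (D : K) + house (a : K) + house (b : K) + house (g : K), ?_, ?_, ?_, ?_, ?_⟩
      <;> linarith
  have hD0 : D ≠ 0 := by
    rintro rfl
    simp at hD
  obtain ⟨m, hm⟩ : ∃ m, m = 2 * h + 4 := ⟨_, rfl⟩
  have hm0 : 0 < m := by lia
  have hm1 : (1 : ℝ) ≤ m := by exact_mod_cast hm0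
  obtain ⟨E, hE⟩ : ∃ E, E = ‖l‖ * (1 + ‖β‖) := ⟨_, rfl⟩
  have hE0 : 0 ≤ E := by rw [hE]; positivity
  obtain ⟨K₁, hK₁⟩ : ∃ K₁, K₁ = C ^ 2 * (4 * m) * (4 * m * H) * H ^ (2 * m) := ⟨_, rfl⟩
  obtain ⟨K₂, hK₂⟩ : ∃ K₂, K₂ = 4 * m * (4 * m * H) * H ^ (2 * m) * K₁ := ⟨_, rfl⟩
  obtain ⟨K₃, hK₃⟩ : ∃ K₃, K₃ = H * H ^ (2 * m) * ‖l‖⁻¹ * (m + 1) ^ m * (4 * m) * K₁ *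
    Real.exp (E * (2 * m * (m + 1))) := ⟨_, rfl⟩
  have hK₁0 : 0 ≤ K₁ := by rw [hK₁]; positivity
  have hK₂0 : 0 ≤ K₂ := by rw [hK₂]; positivity
  have hK₃0 : 0 ≤ K₃ := by rw [hK₃]; positivity
  obtain ⟨k, hk⟩ := exists_nat_gt (K₃ * K₂ ^ h)
  have hk0 : 0 < k := by
    have : (0 : ℝ) < k := lt_of_le_of_lt (by positivity) hk
    exact_mod_cast this
  obtain ⟨n, hn⟩ : ∃ n, n = 2 * m * k ^ 2 := ⟨_, rfl⟩
  obtain ⟨q, hq⟩ : ∃ q, q = 2 * m * k := ⟨_, rfl⟩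
  have hq2 : q ^ 2 = 2 * (m * n) := by rw [hn, hq]; ring
  obtain ⟨c, hc, hc0, hcH⟩ := hC hD0 hH1 hDH haH hbH hgH hm0 (by rw [hn]; positivity) hq2
  classical
  have hex : ∃ r, ∃ s < m, auxValue D a b g (m * q) q c r s ≠ 0 :=
    (exists_auxValue_ne_zero φ hD ha hb hg hβ hm0 hc).imp fun t ht ↦ ⟨0, hm0, ht⟩
  obtain ⟨r, hr⟩ : ∃ r, r = Nat.find hex := ⟨_, rfl⟩
  obtain ⟨s₀, hs₀, hne⟩ := hr ▸ Nat.find_spec hex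
  have hlt : ∀ t < r, ∀ s < m, auxValue D a b g (m * q) q c t s = 0 := fun t ht s hs ↦ by
    by_contra h0
    exact Nat.find_min hex (hr ▸ ht) ⟨s, hs, h0⟩
  have hnr : n ≤ r := by
    by_contra! h0
    exact hne (hc0 r h0 s₀ hs₀)
  have hkn : k ^ 2 ≤ n := by rw [hn]; exact Nat.le_mul_of_pos_left _ (by positivity)
  have hr0 : r ≠ 0 := by
    have := Nat.pow_pos (n := 2) hk0
    lia
  obtain ⟨w, hw⟩ : ∃ w, w = √(r : ℝ) := ⟨_, rfl⟩
  have hw2 : w ^ 2 = r := by rw [hw, sq_sqrt (by positivity)]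
  have hkw : k ≤ w := by
    rw [hw]
    exact Real.le_sqrt_of_sq_le (by exact_mod_cast hkn.trans hnr)
  have hw1 : 1 ≤ w := le_trans (by exact_mod_cast hk0) hkw
  have hqw : q ≤ 2 * m * w := by
    rw [hq]
    push_cast
    gcongr
  have hq2r : (q : ℝ) ^ 2 ≤ (4 * m) ^ r := by
    have h1 : (r : ℝ) ≤ 2 ^ r := by exact_mod_cast r.lt_two_pow_self.le
    have h2 : (2 * m : ℝ) ≤ (2 * m) ^ r := le_self_pow₀ (by linarith) hr0
    calc (q : ℝ) ^ 2 = 2 * m * n := by rw [mul_assoc]; exact_mod_cast hq2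
      _ ≤ 2 * m * r := by gcongr
      _ ≤ (2 * m) ^ r * 2 ^ r := by gcongr
      _ = (4 * m) ^ r := by rw [← mul_pow]; ring
  have hmq : 2 * (m * q) ≤ 2 * m * r := by
    have h1 : q ≤ n := by
      rw [hq, hn, pow_two]
      exact Nat.mul_le_mul_left _ (Nat.le_mul_of_pos_left _ hk0)
    rw [← mul_assoc]
    exact Nat.mul_le_mul_left _ (h1.trans hnr)
  have hHr : H ^ (2 * (m * q)) ≤ (H ^ (2 * m)) ^ r := by
    rw [← pow_mul]
    exact pow_le_pow_right₀ hH1 hmq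
  have hqH1 : 1 ≤ 4 * m * H * w := by
    have := one_le_mul_of_one_le_of_one_le (one_le_mul_of_one_le_of_one_le hm1 hH1) hw1
    linarith
  have hqHr (t : ℕ) (ht : t ≤ r) : (2 * q * H) ^ t ≤ (4 * m * H * w) ^ r :=
    calc (2 * q * H) ^ t ≤ (2 * (2 * m * w) * H) ^ t := by gcongr
      _ = (4 * m * H * w) ^ t := by ring
      _ ≤ _ := pow_le_pow_right₀ hqH1 ht
  have hcr (x) : house (c x : K) ≤ (K₁ * w) ^ r :=
    calc house (c x : K) ≤ C * (C * q ^ 2 * ((2 * q * H) ^ n * H ^ (2 * (m * q)))) := hcH x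
      _ = C ^ 2 * (q ^ 2 * ((2 * q * H) ^ n * H ^ (2 * (m * q)))) := by ring
      _ ≤ (C ^ 2) ^ r * ((4 * m) ^ r * ((4 * m * H * w) ^ r * (H ^ (2 * m)) ^ r)) := by
        gcongr
        · exact le_self_pow₀ (one_le_pow₀ hC1) hr0
        · exact hqHr n hnr
      _ = (K₁ * w) ^ r := by rw [hK₁, ← mul_pow, ← mul_pow, ← mul_pow]; ring
  have hhouse : house (auxValue D a b g (m * q) q c r s₀ : K) ≤ (K₂ * w ^ 2) ^ r :=
    calc _ ≤ q ^ 2 * ((2 * q * H) ^ r * H ^ (2 * (m * q)) * (K₁ * w) ^ r) :=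
        house_auxValue_le hDH haH hbH hgH hs₀ hcr r
      _ ≤ (4 * m) ^ r * ((4 * m * H * w) ^ r * (H ^ (2 * m)) ^ r * (K₁ * w) ^ r) := by
        gcongr ?_ * (?_ * ?_ * _)
        exact hqHr r le_rfl
      _ = (K₂ * w ^ 2) ^ r := by rw [hK₂, ← mul_pow, ← mul_pow, ← mul_pow]; ring
  have hderiv := norm_iteratedDeriv_le_of_forall_lt_iteratedDeriv_eq_zero
    (differentiable_auxFun l β fun x ↦ φ (c x)) (m := m) (r := r) (w := w)
    (B := (4 * m * (K₁ * w) * Real.exp (E * (2 * m * (m + 1)))) ^ r) (by linarith)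
    (fun t ht s hs ↦ by
      have h0 := map_auxValue φ ha hb hg hs c t
      rw [hlt t ht s hs] at h0
      simpa [hD] using h0.symm)
    (fun z hz ↦ by
      refine (norm_auxFun_le (A := (K₁ * w) ^ r)
        (fun x ↦ (norm_embedding_le_house _ φ).trans (hcr x)) z).trans ?_
      rw [mul_pow (4 * m * (K₁ * w)), mul_pow (4 * m : ℝ), mul_assoc ((4 * m : ℝ) ^ r), ← hE, hz,
        ← Real.exp_nat_mul]
      gcongr ?_ * (_ * Real.exp ?_)
      calc E * (q * (w + m)) ≤ E * (2 * m * w * (w + m * w)) := by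
            gcongr
            exact le_mul_of_one_le_right (by positivity) hw1
        _ = w ^ 2 * (E * (2 * m * (m + 1))) := by ring
        _ = _ := by rw [hw2])
    hs₀
  have hφ : ‖φ (auxValue D a b g (m * q) q c r s₀)‖ ≤ (K₃ * w ^ 3 / w ^ m) ^ r := by
    have h0 := congrArg norm (map_auxValue φ ha hb hg hs₀ c r)
    rw [norm_mul, norm_mul, norm_pow, norm_pow] at h0
    have hl0 : 0 < ‖l‖ := norm_pos_iff.2 hl
    have h1 : ‖φ D‖ ^ (r + 2 * (m * q)) ≤ H ^ r * (H ^ (2 * m)) ^ r := by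
      have hφD : ‖φ D‖ ≤ H := (norm_embedding_le_house _ φ).trans hDH
      calc ‖φ D‖ ^ (r + 2 * (m * q)) ≤ H ^ (r + 2 * (m * q)) := by gcongr
        _ = H ^ r * H ^ (2 * (m * q)) := pow_add ..
        _ ≤ _ := by gcongr
    have h2 : (r.factorial : ℝ) ≤ (w ^ 2) ^ r := by
      rw [hw2]
      exact_mod_cast r.factorial_le_pow
    rw [← mul_le_mul_iff_right₀ (pow_pos hl0 r), h0]
    calc _ ≤ H ^ r * (H ^ (2 * m)) ^ r * ((w ^ 2) ^ r * (((m + 1 : ℝ) ^ m) ^ r *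
          ((4 * m * (K₁ * w) * Real.exp (E * (2 * m * (m + 1)))) ^ r / (w ^ m) ^ r))) := by
          refine mul_le_mul h1 (hderiv.trans ?_) (norm_nonneg _) (by positivity)
          gcongr
      _ = ‖l‖ ^ r * (K₃ * w ^ 3 / w ^ m) ^ r := by
          rw [← div_pow, ← mul_pow, ← mul_pow, ← mul_pow, ← mul_pow, ← mul_pow, hK₃]
          congr 1
          field_simp
  have hfinal := one_le_norm_mul_house_pow φ hne
  rw [hh, Nat.add_sub_cancel] at hfinal
  have hlt1 : K₃ * w ^ 3 / w ^ m * (K₂ * w ^ 2) ^ h < 1 := by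
    have : K₃ * w ^ 3 / w ^ m * (K₂ * w ^ 2) ^ h = K₃ * K₂ ^ h / w := by
      rw [hm, mul_pow, ← pow_mul]
      field_simp
      ring
    rw [this, div_lt_one (by linarith)]
    linarith
  refine absurd hfinal (not_le.2 ?_)
  calc _ ≤ (K₃ * w ^ 3 / w ^ m) ^ r * ((K₂ * w ^ 2) ^ r) ^ h := by
        gcongr
        · exact pow_nonneg (house_nonneg _) _
        · exact house_nonneg _
    _ = (K₃ * w ^ 3 / w ^ m * (K₂ * w ^ 2) ^ h) ^ r := by
        rw [mul_pow (K₃ * w ^ 3 / w ^ m), pow_right_comm (K₂ * w ^ 2) r h]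
    _ < 1 := pow_lt_one₀ (by positivity) hlt1 hr0

end GelfondSchneider

/-- The **Gelfond–Schneider theorem**: if `exp l` and `β` are algebraic, `l ≠ 0` and `β` is
irrational, then `exp (β * l)` is transcendental. -/
theorem Complex.transcendental_exp_mul {l β : ℂ} (hl : l ≠ 0)
    (hα : IsAlgebraic ℚ (Complex.exp l)) (hβ : IsAlgebraic ℚ β) (hirr : ∀ r : ℚ, β ≠ r) :
    Transcendental ℚ (Complex.exp (β * l)) := by
  intro hγ
  let S : Finset ℂ := {Complex.exp l, β, Complex.exp (β * l)}
  let K := IntermediateField.adjoin ℚ (S : Set ℂ)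
  have hS : ∀ x ∈ S, IsIntegral ℚ x := by
    simp only [S, Finset.mem_insert, Finset.mem_singleton]
    rintro x (rfl | rfl | rfl)
    exacts [hα.isIntegral, hβ.isIntegral, hγ.isIntegral]
  have : FiniteDimensional ℚ K := IntermediateField.finiteDimensional_adjoin hS
  have : NumberField K := ⟨⟩
  have hmem {x : ℂ} (hx : x ∈ S) : x ∈ K := IntermediateField.subset_adjoin _ _ hx
  let a : K := ⟨Complex.exp l, hmem (by simp [S])⟩
  let b : K := ⟨β, hmem (by simp [S])⟩
  let g : K := ⟨Complex.exp (β * l), hmem (by simp [S])⟩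
  classical
  obtain ⟨y, hy, hyint⟩ := exists_integral_multiples ℤ ℚ ({a, b, g} : Finset K)
  have hy' : (y : ℂ) ≠ 0 := by exact_mod_cast hy
  obtain ⟨r, hr⟩ := GelfondSchneider.exists_rat_eq (K := K) (algebraMap K ℂ)
    (D := (y : NumberField.RingOfIntegers K)) (a := ⟨y • a, hyint a (by simp)⟩)
    (b := ⟨y • b, hyint b (by simp)⟩) (g := ⟨y • g, hyint g (by simp)⟩) (l := l) (β := β) hl
    (by simpa using hy) (by simp [a]) (by simp [b]) (by simp [g])
  exact hirr r hr

/-- The unique solution `ξ ∈ (1/4, 2/3)` of `√(36ξ+3)/4 + sin(2π√(12ξ+1)/3) = 0`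
is transcendental over `ℚ`. -/
theorem backbone_exponent_transcendental (ξ : ℝ)
    (h₁ : ξ ∈ Set.Ioo (1/4 : ℝ) (2/3 : ℝ))
    (h₂ : Real.sqrt (36 * ξ + 3) / 4 + Real.sin (2 * π * Real.sqrt (12 * ξ + 1) / 3) = 0) :
    Transcendental ℚ ξ := by
  intro hξ
  obtain ⟨hξ₁, hξ₂⟩ := h₁
  obtain ⟨x, hx⟩ : ∃ x, x = √(12 * ξ + 1) := ⟨_, rfl⟩
  have hx2 : x ^ 2 = 12 * ξ + 1 := by rw [hx, sq_sqrt (by linarith)]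
  obtain ⟨y, hy⟩ : ∃ y, y = √(36 * ξ + 3) := ⟨_, rfl⟩
  have hy2 : y ^ 2 = 36 * ξ + 3 := by rw [hy, sq_sqrt (by linarith)]
  have hyx : y ^ 2 = 3 * x ^ 2 := by rw [hx2, hy2]; ring
  rw [← hx, ← hy] at h₂
  have hsin : sin (2 * π * x / 3) = -(y / 4) := by linarith
  have halg (k : ℕ) : IsAlgebraic ℚ (k : ℝ) := isAlgebraic_natCast k
  have hxalg : IsAlgebraic ℚ x := by
    refine IsAlgebraic.of_pow two_pos ?_
    rw [hx2]
    exact ((halg 12).mul hξ).add isAlgebraic_one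
  have hyalg : IsAlgebraic ℚ y := by
    refine IsAlgebraic.of_pow two_pos ?_
    rw [hyx]
    exact (halg 3).mul (hxalg.pow 2)
  have hsalg : IsAlgebraic ℚ (sin (2 * π * x / 3)) := by
    rw [hsin, div_eq_mul_inv]
    exact (hyalg.mul (halg 4).inv).neg
  have hcalg : IsAlgebraic ℚ (cos (2 * π * x / 3)) := by
    refine IsAlgebraic.of_pow two_pos ?_
    rw [cos_sq']
    exact isAlgebraic_one.sub (hsalg.pow 2)
  have hofReal {z : ℝ} (hz : IsAlgebraic ℚ z) : IsAlgebraic ℚ (z : ℂ) :=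
    hz.algHom (Complex.ofRealAm.restrictScalars ℚ)
  have hI : IsAlgebraic ℚ Complex.I := by
    refine IsAlgebraic.of_pow two_pos ?_
    rw [Complex.I_sq]
    exact isAlgebraic_one.neg
  have hexp : IsAlgebraic ℚ (Complex.exp (((2 * x / 3 : ℝ) : ℂ) * (π * Complex.I))) := by
    have : ((2 * x / 3 : ℝ) : ℂ) * (π * Complex.I) = ((2 * π * x / 3 : ℝ) : ℂ) * Complex.I := by
      push_cast
      ring
    rw [this, Complex.exp_mul_I, ← Complex.ofReal_cos, ← Complex.ofReal_sin]
    exact (hofReal hcalg).add ((hofReal hsalg).mul hI)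
  obtain ⟨r, hr⟩ : ∃ r : ℚ, ((2 * x / 3 : ℝ) : ℂ) = r := by
    by_contra! hirr
    refine Complex.transcendental_exp_mul (l := π * Complex.I) (by simp) ?_ ?_ hirr hexp
    · rw [Complex.exp_pi_mul_I]
      exact isAlgebraic_one.neg
    · exact hofReal (((halg 2).mul hxalg).mul (halg 3).inv)
  have hr' : 2 * x / 3 = r := by exact_mod_cast hr
  have hyint : IsIntegral ℤ ((2 * sin (r * π)) ^ 2) := (isIntegral_two_mul_sin_rat_mul_pi r).pow 2
  have hval : (2 * sin (r * π)) ^ 2 = ((27 * r ^ 2 / 16 : ℚ) : ℝ) := by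
    rw [← hr', show 2 * x / 3 * π = 2 * π * x / 3 by ring, hsin]
    push_cast
    rw [← hr']
    linear_combination hyx / 4
  rw [hval] at hyint
  obtain ⟨N, hN⟩ := IsIntegrallyClosed.isIntegral_iff.1
    ((isIntegral_algebraMap_iff (algebraMap ℚ ℝ).injective).1 hyint)
  have hN' : (N : ℝ) = y ^ 2 / 4 := by
    have : (N : ℝ) = ((27 * r ^ 2 / 16 : ℚ) : ℝ) := by
      rw [← hN]
      simp
    rw [this, ← hval, ← hr', show 2 * x / 3 * π = 2 * π * x / 3 by ring, hsin]
    ring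
  have hN4 : N = 4 := by
    have h1 : (3 : ℝ) < N := by linarith
    have h2 : (N : ℝ) ≤ 4 := by
      have := sin_sq_le_one (2 * π * x / 3)
      rw [hsin] at this
      linarith
    have h3 : 3 < N := by exact_mod_cast h1
    have h4 : N ≤ 4 := by exact_mod_cast h2
    lia
  have h27 : 27 * r ^ 2 = 64 := by
    rw [hN4] at hN
    simp at hN
    linarith
  have hr0 : r ≠ 0 := by
    rintro rfl
    norm_num at h27
  refine (Nat.prime_three.irrational_sqrt) ⟨|8 / (3 * r)|, ?_⟩
  have h3 : ((8 / (3 * r)) ^ 2 : ℚ) = 3 := by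
    field_simp
    linarith
  rw [Rat.cast_abs, ← Real.sqrt_sq_eq_abs]
  congr 1
  exact_mod_cast h3
end

section
/- For all real a, b > 0, the integral ∫₁^∞ (t^(−a) − t^(−b))/(t − 1) dt converges and equals ψ(b) − ψ(a), where ψ = Γ'/Γ is the digamma function; equivalently, the integral equals (deriv Γ)(b)/Γ(b) − (deriv Γ)(a)/Γ(a). -/
open Real MeasureTheory

open Filter Topology

/-- Monotone convergence for series: a pointwise sum of nonnegative integrable functions whose
integrals are summable is integrable, and its integral is the sum of the integrals. -/
theorem integrable_and_integral_eq_of_hasSum_of_nonneg {α : Type*} [MeasurableSpace α]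
    {μ : Measure α} {F : ℕ → α → ℝ} {f : α → ℝ} {S : ℝ} (hF : ∀ n, Integrable (F n) μ)
    (hpos : ∀ᵐ x ∂μ, ∀ n, 0 ≤ F n x) (hf : ∀ᵐ x ∂μ, HasSum (fun n => F n x) (f x))
    (hS : HasSum (fun n => ∫ x, F n x ∂μ) S) :
    Integrable f μ ∧ ∫ x, f x ∂μ = S := by
  have hsum (N : ℕ) : ∫ x, ∑ n ∈ Finset.range N, F n x ∂μ =
      ∑ n ∈ Finset.range N, ∫ x, F n x ∂μ := integral_finsetSum _ fun n _ => hF n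
  have hlim : ∀ᵐ x ∂μ, Tendsto (fun N => ∑ n ∈ Finset.range N, F n x) atTop (𝓝 (f x)) := by
    filter_upwards [hf] with x hx using hx.tendsto_sum_nat
  have hF_int (N : ℕ) : Integrable (fun x => ∑ n ∈ Finset.range N, F n x) μ :=
    integrable_finsetSum _ fun n _ => hF n
  have hlint (N : ℕ) : ∫⁻ x, ‖∑ n ∈ Finset.range N, F n x‖ₑ ∂μ =
      ENNReal.ofReal (∑ n ∈ Finset.range N, ∫ x, F n x ∂μ) := by
    rw [← hsum, ofReal_integral_eq_lintegral_ofReal (hF_int N)]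
    · refine lintegral_congr_ae ?_
      filter_upwards [hpos] with x hx
      exact Real.enorm_of_nonneg (Finset.sum_nonneg fun n _ => hx n)
    · filter_upwards [hpos] with x hx using Finset.sum_nonneg fun n _ => hx n
  have hfi : Integrable f μ := by
    refine ⟨aestronglyMeasurable_of_tendsto_ae _ (fun N => (hF_int N).aestronglyMeasurable) hlim, ?_⟩
    calc ∫⁻ x, ‖f x‖ₑ ∂μ
        = ∫⁻ x, liminf (fun N => ‖∑ n ∈ Finset.range N, F n x‖ₑ) atTop ∂μ :=
          lintegral_congr_ae (by filter_upwards [hlim] with x hx using hx.enorm.liminf_eq.symm)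
      _ ≤ liminf (fun N => ∫⁻ x, ‖∑ n ∈ Finset.range N, F n x‖ₑ ∂μ) atTop :=
          lintegral_liminf_le' fun N => (hF_int N).aestronglyMeasurable.enorm
      _ = ENNReal.ofReal S := by
          simp_rw [hlint]
          exact ((ENNReal.continuous_ofReal.tendsto S).comp hS.tendsto_sum_nat).liminf_eq
      _ < ⊤ := ENNReal.ofReal_lt_top
  refine ⟨hfi, tendsto_nhds_unique
    (integral_tendsto_of_tendsto_of_monotone hF_int hfi ?_ hlim) ?_⟩
  · filter_upwards [hpos] with x hx
    exact monotone_nat_of_le_succ fun N => by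
      rw [Finset.sum_range_succ]; exact le_add_of_nonneg_right (hx N)
  · simpa only [hsum] using hS.tendsto_sum_nat

theorem differentiableAt_Gamma_of_pos {x : ℝ} (hx : 0 < x) : DifferentiableAt ℝ Real.Gamma x :=
  Real.differentiableAt_Gamma fun m => ((neg_nonpos.mpr m.cast_nonneg).trans_lt hx).ne'

theorem monotoneOn_logDeriv_Gamma : MonotoneOn (logDeriv Real.Gamma) (Set.Ioi 0) := by
  have hmono := Real.convexOn_log_Gamma.monotoneOn_deriv fun x hx =>
    (differentiableAt_Gamma_of_pos hx).log (Real.Gamma_pos_of_pos hx).ne'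
  refine hmono.congr fun x hx => ?_
  exact deriv.log (differentiableAt_Gamma_of_pos hx) (Real.Gamma_pos_of_pos hx).ne'

theorem logDeriv_Gamma_add_one {x : ℝ} (hx : 0 < x) :
    logDeriv Real.Gamma (x + 1) = logDeriv Real.Gamma x + 1 / x := by
  have hG := (Real.Gamma_pos_of_pos hx).ne'
  have hd : deriv Real.Gamma (x + 1) = Real.Gamma x + x * deriv Real.Gamma x := by
    rw [← deriv_comp_add_const]
    have heq : (fun y => Real.Gamma (y + 1)) =ᶠ[𝓝 x] fun y => y * Real.Gamma y := by
      filter_upwards [eventually_gt_nhds hx] with y hy using Real.Gamma_add_one hy.ne'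
    rw [heq.deriv_eq]
    simpa using ((hasDerivAt_id' x).fun_mul (differentiableAt_Gamma_of_pos hx).hasDerivAt).deriv
  rw [logDeriv_apply, logDeriv_apply, hd, Real.Gamma_add_one hx.ne']
  field_simp
  ring

theorem logDeriv_Gamma_add_nat {x : ℝ} (hx : 0 < x) (N : ℕ) :
    logDeriv Real.Gamma (x + N) =
      logDeriv Real.Gamma x + ∑ n ∈ Finset.range N, 1 / (x + n) := by
  induction N with
  | zero => simp
  | succ N ih =>
    rw [Finset.sum_range_succ, Nat.cast_succ, ← add_assoc,
      logDeriv_Gamma_add_one (by positivity), ih, add_assoc]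

theorem tendsto_logDeriv_Gamma_add_nat_sub {a b : ℝ} (ha : 0 < a) (hab : a ≤ b) :
    Tendsto (fun N : ℕ => logDeriv Real.Gamma (b + N) - logDeriv Real.Gamma (a + N)) atTop
      (𝓝 0) := by
  obtain ⟨m, hm⟩ := exists_nat_ge (b - a)
  have hup : Tendsto (fun N : ℕ => (m : ℝ) * (1 / (a + N))) atTop (𝓝 0) := by
    simpa using ((tendsto_atTop_add_const_left _ a
      tendsto_natCast_atTop_atTop).inv_tendsto_atTop (𝕜 := ℝ)).const_mul (m : ℝ)
  refine squeeze_zero (fun N => sub_nonneg.2 ?_) (fun N => ?_) hup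
  · have hN : (0 : ℝ) ≤ N := N.cast_nonneg
    exact monotoneOn_logDeriv_Gamma (Set.mem_Ioi.2 (by linarith)) (Set.mem_Ioi.2 (by linarith))
      (by linarith)
  · have hN : (0 : ℝ) ≤ N := N.cast_nonneg
    have haN : 0 < a + N := by linarith
    have hmono : logDeriv Real.Gamma (b + N) ≤ logDeriv Real.Gamma (a + N + m) :=
      monotoneOn_logDeriv_Gamma (Set.mem_Ioi.2 (by linarith)) (Set.mem_Ioi.2 (by positivity))
        (by linarith)
    have hsum : ∑ n ∈ Finset.range m, 1 / (a + N + n) ≤ m * (1 / (a + N)) := by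
      simpa using Finset.sum_le_card_nsmul (Finset.range m) (fun n => 1 / (a + N + (n : ℝ)))
        (1 / (a + N)) fun n _ =>
          one_div_le_one_div_of_le haN (le_add_of_nonneg_right n.cast_nonneg)
    linarith [logDeriv_Gamma_add_nat haN m]

theorem hasSum_one_div_sub_one_div {a b : ℝ} (ha : 0 < a) (hab : a ≤ b) :
    HasSum (fun n : ℕ => 1 / (a + n) - 1 / (b + n))
      (logDeriv Real.Gamma b - logDeriv Real.Gamma a) := by
  rw [hasSum_iff_tendsto_nat_of_nonneg fun n => sub_nonneg.2 <|
    one_div_le_one_div_of_le (by positivity) (by gcongr)]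
  have h := (tendsto_logDeriv_Gamma_add_nat_sub ha hab).const_sub
    (logDeriv Real.Gamma b - logDeriv Real.Gamma a)
  rw [sub_zero] at h
  refine h.congr fun N => ?_
  rw [logDeriv_Gamma_add_nat ha, logDeriv_Gamma_add_nat (ha.trans_le hab),
    Finset.sum_sub_distrib]
  ring

theorem hasSum_rpow_neg_sub_nat {t : ℝ} (ht : 1 < t) (s : ℝ) :
    HasSum (fun n : ℕ => t ^ (-(s + n) - 1)) (t ^ (-s) / (t - 1)) := by
  have ht0 : 0 < t := one_pos.trans ht
  have h := (hasSum_geometric_of_lt_one (inv_nonneg.2 ht0.le)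
    (inv_lt_one_of_one_lt₀ ht)).mul_left (t ^ (-s) / t)
  have hval : t ^ (-s) / t * (1 - t⁻¹)⁻¹ = t ^ (-s) / (t - 1) := by
    have ht1 : t - 1 ≠ 0 := sub_ne_zero.2 ht.ne'
    rw [show 1 - t⁻¹ = (t - 1) / t by field_simp]
    field_simp
  rw [hval] at h
  refine (funext fun n => ?_ : (fun n : ℕ => t ^ (-(s + n) - 1)) = _) ▸ h
  rw [show -(s + n) - 1 = -s - 1 - (n : ℝ) by ring, Real.rpow_sub ht0, Real.rpow_sub_one ht0.ne',
    Real.rpow_natCast, inv_pow, div_eq_mul_inv _ (t ^ n)]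

theorem integral_Ioi_one_rpow_neg_sub_one {c : ℝ} (hc : 0 < c) :
    ∫ t in Set.Ioi (1 : ℝ), t ^ (-c - 1) = 1 / c := by
  rw [integral_Ioi_rpow_of_lt (by linarith) one_pos, sub_add_cancel, Real.one_rpow, neg_div_neg_eq]

theorem digamma_integral_of_le {a b : ℝ} (ha : 0 < a) (hab : a ≤ b) :
    IntegrableOn (fun t : ℝ => (t ^ (-a) - t ^ (-b)) / (t - 1)) (Set.Ioi 1) ∧
    ∫ t in Set.Ioi (1 : ℝ), (t ^ (-a) - t ^ (-b)) / (t - 1) =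
      logDeriv Real.Gamma b - logDeriv Real.Gamma a := by
  have hF_int {s : ℝ} (hs : 0 < s) (n : ℕ) :
      IntegrableOn (fun t : ℝ => t ^ (-(s + n) - 1)) (Set.Ioi 1) := by
    have hn : (0 : ℝ) ≤ n := n.cast_nonneg
    exact integrableOn_Ioi_rpow_of_lt (by linarith) one_pos
  have hb := ha.trans_le hab
  refine integrable_and_integral_eq_of_hasSum_of_nonneg
    (F := fun (n : ℕ) t => t ^ (-(a + n) - 1) - t ^ (-(b + n) - 1))
    (fun n => (hF_int ha n).sub (hF_int hb n)) ?_ ?_ ?_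
  · refine ae_restrict_of_forall_mem measurableSet_Ioi fun t ht n => sub_nonneg.2 ?_
    exact Real.rpow_le_rpow_of_exponent_le (Set.mem_Ioi.1 ht).le (by linarith)
  · refine ae_restrict_of_forall_mem measurableSet_Ioi fun t ht => ?_
    rw [sub_div]
    exact (hasSum_rpow_neg_sub_nat ht a).sub (hasSum_rpow_neg_sub_nat ht b)
  · convert hasSum_one_div_sub_one_div ha hab using 2 with n
    rw [integral_sub (hF_int ha n) (hF_int hb n), integral_Ioi_one_rpow_neg_sub_one (by positivity),
      integral_Ioi_one_rpow_neg_sub_one (by positivity)]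

/-- For `a, b > 0`, the integral `∫₁^∞ (t^(−a) − t^(−b))/(t − 1) dt` converges and
equals `ψ(b) − ψ(a)`, where `ψ = Γ'/Γ` is the digamma function. -/
theorem digamma_integral (a b : ℝ) (ha : 0 < a) (hb : 0 < b) :
    IntegrableOn (fun t : ℝ => (t ^ (-a) - t ^ (-b)) / (t - 1)) (Set.Ioi 1) ∧
    ∫ t in Set.Ioi (1 : ℝ), (t ^ (-a) - t ^ (-b)) / (t - 1) =
      deriv Real.Gamma b / Real.Gamma b - deriv Real.Gamma a / Real.Gamma a := by
  simp only [← logDeriv_apply]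
  rcases le_total a b with hab | hba
  · exact digamma_integral_of_le ha hab
  · obtain ⟨hi, hv⟩ := digamma_integral_of_le hb hba
    have hswap (t : ℝ) :
        (t ^ (-a) - t ^ (-b)) / (t - 1) = -((t ^ (-b) - t ^ (-a)) / (t - 1)) := by
      rw [← neg_div, neg_sub]
    simp only [hswap]
    exact ⟨hi.neg, by rw [integral_neg, hv, neg_sub]⟩
end

section
/- For every real γ with √2 < γ < 2 and every θ with 0 < θ < 4/γ² − 1, the integral ∫₀^∞ ( μ^(4/γ²)·(μ−1)·(μ^(θ−1)−1)/(μ^(4/γ²) − 1)² + μ^(1−4/γ²) ) dμ converges and equals γ⁴·π·(θ·sin(πγ²/2) − sin(πγ²θ/2)) / (32·cos(πγ²/4)·sin(πγ²θ/4)·sin(πγ²(θ+1)/4)). -/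
open Real MeasureTheory

open Filter Set

/-- The combination `g θ + g 2 - g 1 - g (θ + 1)`, whose weights and first moments both sum to
zero. -/
def secondDiff (θ : ℝ) (g : ℝ → ℝ) : ℝ := g θ + g 2 - g 1 - g (θ + 1)

theorem HasSum.secondDiff {θ : ℝ} {f : ℝ → ℕ → ℝ} {s : ℝ → ℝ}
    (h0 : HasSum (f θ) (s θ)) (h2 : HasSum (f 2) (s 2)) (h1 : HasSum (f 1) (s 1))
    (h3 : HasSum (f (θ + 1)) (s (θ + 1))) :
    HasSum (fun n ↦ secondDiff θ fun c ↦ f c n) (secondDiff θ s) :=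
  ((h0.add h2).sub h1).sub h3

theorem integrable_secondDiff {α : Type*} [MeasurableSpace α] {ν : Measure α} {θ : ℝ}
    {f : ℝ → α → ℝ}
    (h0 : Integrable (f θ) ν) (h2 : Integrable (f 2) ν) (h1 : Integrable (f 1) ν)
    (h3 : Integrable (f (θ + 1)) ν) :
    Integrable (fun x ↦ secondDiff θ fun c ↦ f c x) ν :=
  ((h0.add h2).sub h1).sub h3

theorem integral_secondDiff {α : Type*} [MeasurableSpace α] {ν : Measure α} {θ : ℝ}
    {f : ℝ → α → ℝ}
    (h0 : Integrable (f θ) ν) (h2 : Integrable (f 2) ν) (h1 : Integrable (f 1) ν)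
    (h3 : Integrable (f (θ + 1)) ν) :
    ∫ x, secondDiff θ (fun c ↦ f c x) ∂ν = secondDiff θ fun c ↦ ∫ x, f c x ∂ν := by
  exact (integral_sub' ((h0.add h2).sub h1) h3).trans <| by
    rw [integral_sub' (h0.add h2) h1, integral_add' h0 h2]; rfl

/-- Termwise integration of a series of nonnegative functions whose integrals are summable. -/
theorem integrable_and_hasSum_integral_of_nonneg {α : Type*} [MeasurableSpace α] {ν : Measure α}
    {F : ℕ → α → ℝ} {f : α → ℝ} (hF : ∀ n, Integrable (F n) ν) (hpos : ∀ n, 0 ≤ᵐ[ν] F n)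
    (hs : ∀ᵐ x ∂ν, HasSum (fun n ↦ F n x) (f x)) (hsum : Summable fun n ↦ ∫ x, F n x ∂ν) :
    Integrable f ν ∧ HasSum (fun n ↦ ∫ x, F n x ∂ν) (∫ x, f x ∂ν) := by
  have hpos' : ∀ᵐ x ∂ν, ∀ n, 0 ≤ F n x := ae_all_iff.2 hpos
  constructor
  · have hf0 : 0 ≤ᵐ[ν] f := by
      filter_upwards [hpos', hs] with x h1 h2 using h2.nonneg h1
    have hmeas : AEStronglyMeasurable f ν := by
      refine aestronglyMeasurable_of_tendsto_ae (u := atTop)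
        (f := fun N x ↦ ∑ n ∈ Finset.range N, F n x) (fun N ↦ ?_) ?_
      · exact (integrable_finsetSum _ fun n _ ↦ hF n).1
      · filter_upwards [hs] with x hx using hx.tendsto_sum_nat
    rw [← lintegral_ofReal_ne_top_iff_integrable hmeas hf0]
    have : ∫⁻ x, ENNReal.ofReal (f x) ∂ν = ∫⁻ x, ∑' n, ENNReal.ofReal (F n x) ∂ν := by
      refine lintegral_congr_ae ?_
      filter_upwards [hpos', hs] with x h1 h2
      rw [← h2.tsum_eq, ENNReal.ofReal_tsum_of_nonneg h1 h2.summable]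
    rw [this, lintegral_tsum fun n ↦ (hF n).1.aemeasurable.ennreal_ofReal]
    simp_rw [← fun n ↦ ofReal_integral_eq_lintegral_ofReal (hF n) (hpos n)]
    rw [← ENNReal.ofReal_tsum_of_nonneg (fun n ↦ integral_nonneg_of_ae (hpos n)) hsum]
    exact ENNReal.ofReal_ne_top
  · have h := hasSum_integral_of_summable_integral_norm hF (by
      refine hsum.congr fun n ↦ integral_congr_ae ?_
      filter_upwards [hpos n] with x hx
      exact (Real.norm_of_nonneg hx).symm)
    rwa [integral_congr_ae (hs.mono fun x hx ↦ hx.tsum_eq)] at h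

theorem hasSum_succ_mul_pow_succ {r : ℝ} (h0 : 0 ≤ r) (h1 : r < 1) :
    HasSum (fun n : ℕ ↦ ((n : ℝ) + 1) * r ^ (n + 1)) (r / (1 - r) ^ 2) := by
  have h := hasSum_coe_mul_geometric_of_norm_lt_one (𝕜 := ℝ) (r := r)
    (by rwa [Real.norm_of_nonneg h0])
  rw [← hasSum_nat_add_iff' 1] at h
  simpa using h

theorem integrableOn_Ioo_rpow_sub_one {c : ℝ} (hc : 0 < c) :
    IntegrableOn (fun x : ℝ ↦ x ^ (c - 1)) (Ioo 0 1) :=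
  (intervalIntegral.integrableOn_Ioo_rpow_iff one_pos).2 (by linarith)

theorem integral_Ioo_rpow_sub_one {c : ℝ} (hc : 0 < c) :
    ∫ x in Ioo (0 : ℝ) 1, x ^ (c - 1) = 1 / c := by
  rw [← integral_Ioc_eq_integral_Ioo, ← intervalIntegral.integral_of_le zero_le_one,
    integral_rpow (Or.inl (by linarith)), zero_rpow (by linarith)]
  simp

theorem integrableOn_Ioi_one_rpow_sub_one {c : ℝ} (hc : c < 0) :
    IntegrableOn (fun x : ℝ ↦ x ^ (c - 1)) (Ioi 1) :=
  integrableOn_Ioi_rpow_of_lt (by linarith) one_pos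

theorem integral_Ioi_one_rpow_sub_one {c : ℝ} (hc : c < 0) :
    ∫ x in Ioi (1 : ℝ), x ^ (c - 1) = -(1 / c) := by
  rw [integral_Ioi_rpow_of_lt (by linarith) one_pos]
  simp [neg_div]

theorem secondDiff_rpow {θ b μ : ℝ} (hμ : 0 < μ) :
    secondDiff θ (fun c ↦ μ ^ (b + c - 1)) = μ ^ b * -((μ - 1) * (μ ^ (θ - 1) - 1)) := by
  have e1 : μ ^ (b + θ - 1) = μ ^ b * μ ^ (θ - 1) := by rw [← rpow_add hμ]; ring_nf
  have e2 : μ ^ (b + 2 - 1) = μ ^ b * μ := by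
    rw [← rpow_add_one hμ.ne']; ring_nf
  have e3 : μ ^ (b + 1 - 1) = μ ^ b := by ring_nf
  have e4 : μ ^ (b + (θ + 1) - 1) = μ ^ b * (μ ^ (θ - 1) * μ) := by
    rw [← rpow_add_one hμ.ne', ← rpow_add hμ]; ring_nf
  simp only [secondDiff, e1, e2, e3, e4]
  ring

theorem secondDiff_rpow_nonneg {θ b μ : ℝ} (hμ : 0 < μ) (hθ : θ ≤ 1) :
    0 ≤ secondDiff θ fun c ↦ μ ^ (b + c - 1) := by
  rw [secondDiff_rpow hμ]
  refine mul_nonneg (rpow_nonneg hμ.le _) ?_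
  rcases le_total μ 1 with h | h
  · have := one_le_rpow_of_pos_of_le_one_of_nonpos hμ h (by linarith : θ - 1 ≤ 0)
    nlinarith
  · have := rpow_le_one_of_one_le_of_nonpos h (by linarith : θ - 1 ≤ 0)
    nlinarith

theorem hasSum_secondDiff_rpow {θ b μ : ℝ} (hμ : 0 < μ) (hb : μ ^ b < 1) :
    HasSum (fun n : ℕ ↦ ((n : ℝ) + 1) * secondDiff θ fun c ↦ μ ^ (((n : ℝ) + 1) * b + c - 1))
      (-(μ ^ b * (μ - 1) * (μ ^ (θ - 1) - 1) / (μ ^ b - 1) ^ 2)) := by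
  have h := (hasSum_succ_mul_pow_succ (rpow_nonneg hμ.le b) hb).mul_right
    (-((μ - 1) * (μ ^ (θ - 1) - 1)))
  convert! h using 1
  · ext n
    rw [secondDiff_rpow hμ, ← rpow_natCast, ← rpow_mul hμ.le, mul_comm b]
    push_cast
    ring
  · rw [← neg_sub (1 : ℝ) (μ ^ b), neg_sq]
    ring

theorem summable_div_add_sub {a : ℝ} (ha : 0 < a) (c : ℝ) :
    Summable fun n : ℕ ↦
      ((n : ℝ) + 1) / (((n : ℝ) + 1) * a + c) - 1 / a + c / (a ^ 2 * ((n : ℝ) + 1)) := by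
  have hs : Summable fun n : ℕ ↦ 2 * c ^ 2 / a ^ 3 * (1 / ((n : ℝ) + 1) ^ 2) := by
    refine Summable.mul_left _ ?_
    have := (summable_nat_add_iff 1).2 (Real.summable_one_div_nat_pow.2 one_lt_two)
    simpa using this
  refine Summable.of_norm_bounded_eventually_nat hs ?_
  obtain ⟨N, hN⟩ := exists_nat_gt (2 * |c| / a)
  filter_upwards [eventually_ge_atTop N] with n hn
  have hn' : 2 * |c| / a < (n : ℝ) + 1 := hN.trans_le (by
    have : (N : ℝ) ≤ n := by exact_mod_cast hn
    linarith)
  rw [div_lt_iff₀ ha] at hn'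
  have hn0 : (0 : ℝ) < (n : ℝ) + 1 := by positivity
  have hlow : ((n : ℝ) + 1) * a / 2 ≤ ((n : ℝ) + 1) * a + c := by
    linarith [neg_abs_le c]
  have hpos : 0 < ((n : ℝ) + 1) * a + c := lt_of_lt_of_le (by positivity) hlow
  have key : ((n : ℝ) + 1) / (((n : ℝ) + 1) * a + c) - 1 / a + c / (a ^ 2 * ((n : ℝ) + 1))
      = c ^ 2 / (a ^ 2 * ((n : ℝ) + 1) * (((n : ℝ) + 1) * a + c)) := by
    field_simp
    ring
  rw [key, Real.norm_of_nonneg (by positivity)]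
  calc _ ≤ c ^ 2 / (a ^ 2 * ((n : ℝ) + 1) * (((n : ℝ) + 1) * a / 2)) := by gcongr
    _ = _ := by field_simp

theorem summable_secondDiff_div_add {a : ℝ} (ha : 0 < a) (θ σ : ℝ) :
    Summable fun n : ℕ ↦ secondDiff θ fun c ↦ ((n : ℝ) + 1) / (((n : ℝ) + 1) * a + σ * c) := by
  have h (c : ℝ) := summable_div_add_sub ha (σ * c)
  refine ((((h θ).add (h 2)).sub (h 1)).sub (h (θ + 1))).congr fun n ↦ ?_
  simp only [secondDiff]
  ring

theorem hasSum_cot_series {x : ℝ} (hx : ∀ k : ℤ, (k : ℝ) ≠ x) :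
    HasSum (fun n : ℕ ↦ 1 / (x - ((n : ℝ) + 1)) + 1 / (x + ((n : ℝ) + 1)))
      (π * Real.cot (π * x) - 1 / x) := by
  have hx' : (x : ℂ) ∈ Complex.integerComplement := by
    rintro ⟨k, hk⟩
    exact hx k (by exact_mod_cast hk)
  have h := (summable_cotTerm hx').hasSum
  rw [← Complex.hasSum_ofReal]
  have h2 := cot_series_rep' hx'
  simp only [cotTerm] at h
  push_cast
  rw [h2]
  exact h

theorem hasSum_div_add_add_div_sub {a c : ℝ} (ha : 0 < a) (hc : c ≠ 0)
    (hx : ∀ k : ℤ, (k : ℝ) ≠ c / a) :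
    HasSum (fun n : ℕ ↦ ((n : ℝ) + 1) / (((n : ℝ) + 1) * a + c) +
        ((n : ℝ) + 1) / (((n : ℝ) + 1) * a - c) - 2 / a)
      (1 / a - π * c / a ^ 2 * Real.cot (π * (c / a))) := by
  convert! (hasSum_cot_series hx).mul_left (-(c / a ^ 2)) using 1
  · ext n
    have h1 : c / a + ((n : ℝ) + 1) ≠ 0 := fun h ↦ hx (-(n + 1)) (by push_cast; linarith)
    have h2 : c / a - ((n : ℝ) + 1) ≠ 0 := fun h ↦ hx (n + 1) (by push_cast; linarith)
    have h1' : ((n : ℝ) + 1) * a + c ≠ 0 := fun h ↦ h1 (by field_simp; linarith)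
    have h2' : ((n : ℝ) + 1) * a - c ≠ 0 := fun h ↦ h2 (by field_simp; linarith)
    have e1 : c / a + ((n : ℝ) + 1) = (((n : ℝ) + 1) * a + c) / a := by field_simp; ring
    have e2 : c / a - ((n : ℝ) + 1) = -((((n : ℝ) + 1) * a - c) / a) := by field_simp; ring
    rw [e1, e2]
    field_simp
    ring
  · field_simp
    ring

theorem integrableOn_Ioo_and_hasSum {a θ : ℝ} (ha : 0 < a) (hθ₀ : 0 < θ) (hθ₁ : θ ≤ 1) :
    IntegrableOn (fun μ : ℝ ↦ -(μ ^ a * (μ - 1) * (μ ^ (θ - 1) - 1) / (μ ^ a - 1) ^ 2)) (Ioo 0 1) ∧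
    HasSum (fun n : ℕ ↦ secondDiff θ fun c ↦ ((n : ℝ) + 1) / (((n : ℝ) + 1) * a + c))
      (∫ μ in Ioo (0 : ℝ) 1, -(μ ^ a * (μ - 1) * (μ ^ (θ - 1) - 1) / (μ ^ a - 1) ^ 2)) := by
  have hi (n : ℕ) (c : ℝ) (hc : 0 < c) :
      IntegrableOn (fun μ : ℝ ↦ μ ^ (((n : ℝ) + 1) * a + c - 1)) (Ioo 0 1) :=
    integrableOn_Ioo_rpow_sub_one (by positivity)
  have h2 := fun n ↦ hi n 2 two_pos
  have h1 := fun n ↦ hi n 1 one_pos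
  have h3 := fun n ↦ hi n (θ + 1) (by positivity)
  have hint (n : ℕ) : ∫ μ in Ioo (0 : ℝ) 1, ((n : ℝ) + 1) *
      secondDiff θ (fun c ↦ μ ^ (((n : ℝ) + 1) * a + c - 1)) =
      secondDiff θ fun c ↦ ((n : ℝ) + 1) / (((n : ℝ) + 1) * a + c) := by
    rw [integral_const_mul, integral_secondDiff
      (f := fun c μ ↦ μ ^ (((n : ℝ) + 1) * a + c - 1))
      (hi n θ hθ₀) (h2 n) (h1 n) (h3 n)]
    simp only [secondDiff]
    rw [integral_Ioo_rpow_sub_one (by positivity), integral_Ioo_rpow_sub_one (by positivity),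
      integral_Ioo_rpow_sub_one (by positivity), integral_Ioo_rpow_sub_one (by positivity)]
    ring
  have h := integrable_and_hasSum_integral_of_nonneg (ν := volume.restrict (Ioo (0 : ℝ) 1))
    (F := fun n μ ↦ ((n : ℝ) + 1) * secondDiff θ fun c ↦ μ ^ (((n : ℝ) + 1) * a + c - 1))
    (f := fun μ ↦ -(μ ^ a * (μ - 1) * (μ ^ (θ - 1) - 1) / (μ ^ a - 1) ^ 2))
    (fun n ↦ (integrable_secondDiff (f := fun c μ ↦ μ ^ (((n : ℝ) + 1) * a + c - 1))
      (hi n θ hθ₀) (h2 n) (h1 n) (h3 n)).const_mul _)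
    (fun n ↦ by
      filter_upwards [ae_restrict_mem measurableSet_Ioo] with μ hμ
      exact mul_nonneg (by positivity) (secondDiff_rpow_nonneg hμ.1 hθ₁))
    (by
      filter_upwards [ae_restrict_mem measurableSet_Ioo] with μ hμ
      exact hasSum_secondDiff_rpow hμ.1 (rpow_lt_one hμ.1.le hμ.2 ha))
    (by
      simp only [hint]
      simpa using summable_secondDiff_div_add ha θ 1)
  simp only [hint] at h
  exact h

theorem integrableOn_Ioi_and_hasSum {a θ : ℝ} (ha : 1 < a) (hθ₀ : 0 < θ) (hθ₁ : θ < a - 1)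
    (hθ₂ : θ ≤ 1) :
    IntegrableOn (fun μ : ℝ ↦ -(μ ^ a * (μ - 1) * (μ ^ (θ - 1) - 1) / (μ ^ a - 1) ^ 2) -
      secondDiff θ fun c ↦ μ ^ (-a + c - 1)) (Ioi 1) ∧
    HasSum (fun n : ℕ ↦ secondDiff θ fun c ↦
        (((n + 1 : ℕ) : ℝ) + 1) / ((((n + 1 : ℕ) : ℝ) + 1) * a - c))
      (∫ μ in Ioi (1 : ℝ), (-(μ ^ a * (μ - 1) * (μ ^ (θ - 1) - 1) / (μ ^ a - 1) ^ 2) -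
        secondDiff θ fun c ↦ μ ^ (-a + c - 1))) := by
  have hneg (n : ℕ) (c : ℝ) (hc : c ≤ 2) : (((n + 1 : ℕ) : ℝ) + 1) * -a + c < 0 := by
    push_cast
    nlinarith [n.cast_nonneg (α := ℝ)]
  have hi (n : ℕ) (c : ℝ) (hc : c ≤ 2) :
      IntegrableOn (fun μ : ℝ ↦ μ ^ ((((n + 1 : ℕ) : ℝ) + 1) * -a + c - 1)) (Ioi 1) :=
    integrableOn_Ioi_one_rpow_sub_one (hneg n c hc)
  have h0 := fun n ↦ hi n θ (by linarith)
  have h2 := fun n ↦ hi n 2 le_rfl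
  have h1 := fun n ↦ hi n 1 one_le_two
  have h3 := fun n ↦ hi n (θ + 1) (by linarith)
  have hval (n : ℕ) (c : ℝ) (hc : c ≤ 2) :
      ∫ μ in Ioi (1 : ℝ), μ ^ ((((n + 1 : ℕ) : ℝ) + 1) * -a + c - 1) =
        1 / ((((n + 1 : ℕ) : ℝ) + 1) * a - c) := by
    rw [integral_Ioi_one_rpow_sub_one (hneg n c hc), ← div_neg]
    ring_nf
  have hint (n : ℕ) : ∫ μ in Ioi (1 : ℝ), (((n + 1 : ℕ) : ℝ) + 1) *
      secondDiff θ (fun c ↦ μ ^ ((((n + 1 : ℕ) : ℝ) + 1) * -a + c - 1)) =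
      secondDiff θ fun c ↦ (((n + 1 : ℕ) : ℝ) + 1) / ((((n + 1 : ℕ) : ℝ) + 1) * a - c) := by
    rw [integral_const_mul, integral_secondDiff
      (f := fun c μ ↦ μ ^ ((((n + 1 : ℕ) : ℝ) + 1) * -a + c - 1))
      (h0 n) (h2 n) (h1 n) (h3 n)]
    simp only [secondDiff]
    rw [hval n θ (by linarith), hval n 2 le_rfl, hval n 1 one_le_two,
      hval n (θ + 1) (by linarith)]
    ring
  have h := integrable_and_hasSum_integral_of_nonneg (ν := volume.restrict (Ioi (1 : ℝ)))
    (F := fun n μ ↦ (((n + 1 : ℕ) : ℝ) + 1) *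
      secondDiff θ fun c ↦ μ ^ ((((n + 1 : ℕ) : ℝ) + 1) * -a + c - 1))
    (f := fun μ ↦ -(μ ^ a * (μ - 1) * (μ ^ (θ - 1) - 1) / (μ ^ a - 1) ^ 2) -
      secondDiff θ fun c ↦ μ ^ (-a + c - 1))
    (fun n ↦ (integrable_secondDiff (f := fun c μ ↦ μ ^ ((((n + 1 : ℕ) : ℝ) + 1) * -a + c - 1))
      (h0 n) (h2 n) (h1 n) (h3 n)).const_mul _)
    (fun n ↦ by
      filter_upwards [ae_restrict_mem measurableSet_Ioi] with μ hμ
      exact mul_nonneg (by positivity) (secondDiff_rpow_nonneg (one_pos.trans hμ) hθ₂))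
    (by
      filter_upwards [ae_restrict_mem measurableSet_Ioi] with μ hμ
      have hμ0 : 0 < μ := one_pos.trans hμ
      have hlt : 1 < μ ^ a := one_lt_rpow hμ (by linarith)
      have hs := (hasSum_nat_add_iff' 1).2 (hasSum_secondDiff_rpow (θ := θ) hμ0
        (rpow_lt_one_of_one_lt_of_neg hμ (by linarith : -a < 0)))
      convert! hs using 1
      rw [rpow_neg hμ0.le]
      have : μ ^ a - 1 ≠ 0 := by linarith
      have : 1 - μ ^ a ≠ 0 := by linarith
      simp only [Finset.sum_range_one, Nat.cast_zero, zero_add, one_mul]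
      congr 2
      field_simp
      rw [← neg_sub (μ ^ a), neg_sq])
    (by
      simp only [hint]
      have := (summable_nat_add_iff 1).2 (summable_secondDiff_div_add (by linarith : 0 < a) θ (-1))
      simpa [sub_eq_add_neg] using this)
  simp only [hint] at h
  exact h

theorem hasSum_secondDiff_div_add_add_div_sub {a θ : ℝ} (ha : 0 < a) (ha₂ : a < 2)
    (hθ₀ : 0 < θ) (hθ₁ : θ < a - 1) :
    HasSum (fun n : ℕ ↦ (secondDiff θ fun c ↦ ((n : ℝ) + 1) / (((n : ℝ) + 1) * a + c)) +
        secondDiff θ fun c ↦ ((n : ℝ) + 1) / (((n : ℝ) + 1) * a - c))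
      (secondDiff θ fun c ↦ 1 / a - π * c / a ^ 2 * Real.cot (π * (c / a))) := by
  have hx (c : ℝ) (m : ℤ) (h1 : m * a < c) (h2 : c < (m + 1) * a) (k : ℤ) : (k : ℝ) ≠ c / a := by
    rw [← lt_div_iff₀ ha] at h1
    rw [← div_lt_iff₀ ha] at h2
    intro hk
    rw [← hk] at h1 h2
    norm_cast at h1 h2
    omega
  have h := HasSum.secondDiff (θ := θ)
    (f := fun c n ↦ ((n : ℝ) + 1) / (((n : ℝ) + 1) * a + c) +
      ((n : ℝ) + 1) / (((n : ℝ) + 1) * a - c) - 2 / a)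
    (s := fun c ↦ 1 / a - π * c / a ^ 2 * Real.cot (π * (c / a)))
    (hasSum_div_add_add_div_sub ha hθ₀.ne' (hx θ 0 (by simpa) (by push_cast; linarith)))
    (hasSum_div_add_add_div_sub ha two_ne_zero
      (hx 2 1 (by push_cast; linarith) (by push_cast; linarith)))
    (hasSum_div_add_add_div_sub ha one_ne_zero (hx 1 0 (by simp) (by push_cast; linarith)))
    (hasSum_div_add_add_div_sub ha (by positivity)
      (hx (θ + 1) 0 (by push_cast; linarith) (by push_cast; linarith)))
  have e : (fun n : ℕ ↦ (secondDiff θ fun c ↦ ((n : ℝ) + 1) / (((n : ℝ) + 1) * a + c)) +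
      secondDiff θ fun c ↦ ((n : ℝ) + 1) / (((n : ℝ) + 1) * a - c)) =
      fun n : ℕ ↦ secondDiff θ fun c ↦ ((n : ℝ) + 1) / (((n : ℝ) + 1) * a + c) +
        ((n : ℝ) + 1) / (((n : ℝ) + 1) * a - c) - 2 / a := by
    ext n
    simp only [secondDiff]
    ring
  rw [e]
  exact h

theorem integrableOn_and_integral_eq_secondDiff {a θ : ℝ} (ha₁ : 1 < a) (ha₂ : a < 2)
    (hθ₀ : 0 < θ) (hθ₁ : θ < a - 1) :
    IntegrableOn (fun μ : ℝ ↦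
      μ ^ a * (μ - 1) * (μ ^ (θ - 1) - 1) / (μ ^ a - 1) ^ 2 + μ ^ (1 - a)) (Ioi 0) ∧
    ∫ μ in Ioi (0 : ℝ),
      (μ ^ a * (μ - 1) * (μ ^ (θ - 1) - 1) / (μ ^ a - 1) ^ 2 + μ ^ (1 - a)) =
    -secondDiff θ fun c ↦ 1 / a - π * c / a ^ 2 * Real.cot (π * (c / a)) := by
  set f : ℝ → ℝ := fun μ ↦
    μ ^ a * (μ - 1) * (μ ^ (θ - 1) - 1) / (μ ^ a - 1) ^ 2 + μ ^ (1 - a) with hf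
  obtain ⟨hi₁, hs₁⟩ := integrableOn_Ioo_and_hasSum (a := a) (by linarith) hθ₀
    (by linarith : θ ≤ 1)
  obtain ⟨hi₂, hs₂⟩ := integrableOn_Ioi_and_hasSum ha₁ hθ₀ hθ₁ (by linarith)
  rw [hasSum_nat_add_iff (f := fun n : ℕ ↦ secondDiff θ fun c ↦
    ((n : ℝ) + 1) / (((n : ℝ) + 1) * a - c)) 1] at hs₂
  have hsum := (hs₁.add hs₂).unique (hasSum_secondDiff_div_add_add_div_sub (by linarith) ha₂ hθ₀ hθ₁)
  have hp : IntegrableOn (fun μ : ℝ ↦ μ ^ ((2 - a) - 1)) (Ioo 0 1) :=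
    integrableOn_Ioo_rpow_sub_one (by linarith)
  have hq (c : ℝ) (hc : c < a) : IntegrableOn (fun μ : ℝ ↦ μ ^ ((-a + c) - 1)) (Ioi 1) :=
    integrableOn_Ioi_one_rpow_sub_one (by linarith)
  have hqv (c : ℝ) (hc : c < a) : ∫ μ in Ioi (1 : ℝ), μ ^ ((-a + c) - 1) = 1 / (a - c) := by
    rw [integral_Ioi_one_rpow_sub_one (by linarith), ← div_neg]
    ring_nf
  have hf₁ : f = fun μ ↦ μ ^ ((2 - a) - 1) -
      -(μ ^ a * (μ - 1) * (μ ^ (θ - 1) - 1) / (μ ^ a - 1) ^ 2) := by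
    ext μ
    rw [hf]
    ring_nf
  have hf₂ : f = fun μ ↦ μ ^ ((-a + 1) - 1) + μ ^ ((-a + (θ + 1)) - 1) - μ ^ ((-a + θ) - 1) -
      (-(μ ^ a * (μ - 1) * (μ ^ (θ - 1) - 1) / (μ ^ a - 1) ^ 2) -
        secondDiff θ fun c ↦ μ ^ (-a + c - 1)) := by
    ext μ
    simp only [hf, secondDiff]
    ring_nf
  have hA₁ : IntegrableOn (fun μ : ℝ ↦ μ ^ ((-a + 1) - 1) + μ ^ ((-a + (θ + 1)) - 1)) (Ioi 1) :=
    (hq 1 ha₁).add (hq (θ + 1) (by linarith))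
  have hA := hA₁.sub (hq θ (by linarith))
  have hI₁ : IntegrableOn f (Ioo 0 1) := by rw [hf₁]; exact hp.sub hi₁
  have hI₂ : IntegrableOn f (Ioi 1) := by rw [hf₂]; exact hA.sub hi₂
  have hv₁ : ∫ μ in Ioo (0 : ℝ) 1, f μ = 1 / (2 - a) -
      ∫ μ in Ioo (0 : ℝ) 1, -(μ ^ a * (μ - 1) * (μ ^ (θ - 1) - 1) / (μ ^ a - 1) ^ 2) := by
    rw [← integral_Ioo_rpow_sub_one (by linarith : 0 < 2 - a), hf₁]
    exact integral_sub hp hi₁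
  have hv₂ : ∫ μ in Ioi (1 : ℝ), f μ =
      1 / (a - 1) + 1 / (a - (θ + 1)) - 1 / (a - θ) - ∫ μ in Ioi (1 : ℝ),
        (-(μ ^ a * (μ - 1) * (μ ^ (θ - 1) - 1) / (μ ^ a - 1) ^ 2) -
          secondDiff θ fun c ↦ μ ^ (-a + c - 1)) := by
    rw [← hqv 1 ha₁, ← hqv (θ + 1) (by linarith), ← hqv θ (by linarith), hf₂,
      ← integral_add (hq 1 ha₁) (hq (θ + 1) (by linarith)),
      ← integral_sub hA₁ (hq θ (by linarith))]
    exact integral_sub hA hi₂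
  have hI₁' : IntegrableOn f (Ioc 0 1) := (integrableOn_Ioc_iff_integrableOn_Ioo).2 hI₁
  have hU : Ioi (0 : ℝ) = Ioc 0 1 ∪ Ioi 1 := (Ioc_union_Ioi_eq_Ioi zero_le_one).symm
  rw [hU]
  refine ⟨hI₁'.union hI₂, ?_⟩
  rw [setIntegral_union (Ioc_disjoint_Ioi le_rfl) measurableSet_Ioi hI₁' hI₂,
    integral_Ioc_eq_integral_Ioo, hv₁, hv₂, ← hsum]
  have e : a - 2 = -(2 - a) := by ring
  simp only [secondDiff, Finset.sum_range_one, Nat.cast_zero, zero_add, one_mul, e, div_neg]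
  ring

theorem secondDiff_mul_cot {a b θ : ℝ} (hcb : cos b ≠ 0) (hsb : sin b ≠ 0)
    (hs : sin (θ * b) ≠ 0) (hs' : sin ((θ + 1) * b) ≠ 0) :
    -(secondDiff θ fun c ↦ 1 / a - π * c / a ^ 2 * Real.cot (c * b)) =
      π / a ^ 2 * ((θ * sin (2 * b) - sin (2 * (θ * b))) /
        (2 * cos b * sin (θ * b) * sin ((θ + 1) * b))) := by
  have hexp : (θ + 1) * b = θ * b + b := by ring
  rw [hexp, sin_add] at hs'
  simp only [secondDiff, cot_eq_cos_div_sin, one_mul, hexp, sin_add, cos_add, sin_two_mul,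
    cos_two_mul']
  have h₁ := sin_sq_add_cos_sq b
  have h₂ := sin_sq_add_cos_sq (θ * b)
  generalize sin (θ * b) = s at *
  generalize cos (θ * b) = c at *
  generalize sin b = S at *
  generalize cos b = C at *
  have key : θ * (c / s) + 2 * ((C ^ 2 - S ^ 2) / (2 * S * C)) - C / S -
      (θ + 1) * ((c * C - s * S) / (s * C + c * S)) =
      (θ * (2 * S * C) - 2 * s * c) / (2 * C * s * (s * C + c * S)) := by
    field_simp
    linear_combination θ * S ^ 2 * C * h₂ - S * s * c * h₁
  rw [mul_assoc 2 s c] at key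
  rw [mul_assoc 2 s c, ← key]
  ring

/-- For `√2 < γ < 2` and `0 < θ < 4/γ² − 1`, the integral
`∫₀^∞ ( μ^(4/γ²)(μ−1)(μ^(θ−1)−1)/(μ^(4/γ²)−1)² + μ^(1−4/γ²) ) dμ` converges and equals
`γ⁴π(θ sin(πγ²/2) − sin(πγ²θ/2)) / (32 cos(πγ²/4) sin(πγ²θ/4) sin(πγ²(θ+1)/4))`. -/
theorem key_integral (γ θ : ℝ) (hγ₁ : Real.sqrt 2 < γ) (hγ₂ : γ < 2)
    (hθ₁ : 0 < θ) (hθ₂ : θ < 4 / γ ^ 2 - 1) :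
    IntegrableOn (fun μ : ℝ =>
      μ ^ (4 / γ ^ 2) * (μ - 1) * (μ ^ (θ - 1) - 1) / (μ ^ (4 / γ ^ 2) - 1) ^ 2 +
        μ ^ (1 - 4 / γ ^ 2)) (Set.Ioi 0) ∧
    ∫ μ in Set.Ioi (0 : ℝ),
      (μ ^ (4 / γ ^ 2) * (μ - 1) * (μ ^ (θ - 1) - 1) / (μ ^ (4 / γ ^ 2) - 1) ^ 2 +
        μ ^ (1 - 4 / γ ^ 2)) =
      γ ^ 4 * π * (θ * Real.sin (π * γ ^ 2 / 2) - Real.sin (π * γ ^ 2 * θ / 2)) /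
        (32 * Real.cos (π * γ ^ 2 / 4) * Real.sin (π * γ ^ 2 * θ / 4) *
          Real.sin (π * γ ^ 2 * (θ + 1) / 4)) := by
  have hγ : 0 < γ := (sqrt_nonneg 2).trans_lt hγ₁
  have hγ2 : 2 < γ ^ 2 := (sqrt_lt' hγ).1 hγ₁
  have hγ4 : γ ^ 2 < 4 := by nlinarith
  have ha₁ : 1 < 4 / γ ^ 2 := by rw [lt_div_iff₀ (by positivity)]; linarith
  have ha₂ : 4 / γ ^ 2 < 2 := by rw [div_lt_iff₀ (by positivity)]; linarith
  have h := integrableOn_and_integral_eq_secondDiff ha₁ ha₂ hθ₁ hθ₂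
  refine ⟨h.1, h.2.trans ?_⟩
  have hπ := pi_pos
  have hlt : (θ + 1) * γ ^ 2 < 4 := by
    rw [← lt_div_iff₀ (by positivity)]
    linarith
  set b := π * γ ^ 2 / 4 with hb
  have hb0 : 0 < b := by positivity
  have hbθ : (θ + 1) * b < π := by
    rw [hb]
    nlinarith
  have hbθ' : 0 < θ * b := by positivity
  have hb2 : π / 2 < b := by
    rw [hb]
    nlinarith
  have key := secondDiff_mul_cot (a := 4 / γ ^ 2) (b := b) (θ := θ)
    (cos_neg_of_pi_div_two_lt_of_lt hb2 (by linarith)).ne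
    (sin_pos_of_pos_of_lt_pi hb0 (by linarith)).ne'
    (sin_pos_of_pos_of_lt_pi hbθ' (by linarith)).ne'
    (sin_pos_of_pos_of_lt_pi (by positivity) hbθ).ne'
  have e1 (c : ℝ) : π * (c / (4 / γ ^ 2)) = c * b := by
    rw [hb]
    field_simp
  have e2 : π * γ ^ 2 / 2 = 2 * b := by rw [hb]; ring
  have e3 : π * γ ^ 2 * θ / 2 = 2 * (θ * b) := by rw [hb]; ring
  have e4 : π * γ ^ 2 * θ / 4 = θ * b := by rw [hb]; ring
  have e5 : π * γ ^ 2 * (θ + 1) / 4 = (θ + 1) * b := by rw [hb]; ring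
  simp only [e1, e2, e3, e4, e5]
  rw [key]
  field_simp
  ring
end
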